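/- Let π be an alternating binary protocol of length N (N even) and let T ∈ ℕ be arbitrary. In any execution of the coding scheme Π (Algorithms 1–2) on inputs (x,y) whose erasure pattern erases at most T timesteps in total, both Alice and Bob terminate and both output the noiseless transcript T^π of π on (x,y). Moreover, the total number of symbols sent, which equals t_A + t_B − 1, is at most N + 2T, and hence the communication in bits over the 4-ary alphabet is at most 2N + 4T. -/

import Mathlib

/-!
Model of the coding scheme Π (Algorithms 1–2) of "Interactive coding resilient to an
unknown number of erasures".  A noiseless alternating binary protocol `π` of length `N`
is given by next-bit functions `fA fB : List Bool → Bool` (`fA t = π(x∣t)` on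
even-length transcripts `t`, `fB t = π(y∣t)` on odd-length transcripts `t`).
Rounds are 1-indexed; round `i` consists of two timesteps whose erasures are given by
`(E i).1` (odd timestep, Alice → Bob) and `(E i).2` (even timestep, Bob → Alice).
-/

namespace Scheme1

/-- Parity of a round number, as a Boolean. -/
def par (r : ℕ) : Bool := decide (r % 2 = 1)

/-- The joint state of Alice and Bob at the beginning of a round:
Alice's partial transcript `TA` and round counter `rA`; Bob's partial transcript `TB`,
round counter `rB`, error flag `err` and stored message `m = (bit, parity)`. -/
structure St where
  TA : List Bool
  rA : ℕ
  TB : List Bool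
  rB : ℕ
  err : Bool
  m : Bool × Bool
deriving DecidableEq

/-- The initial state. -/
def init : St := ⟨[], 0, [], 0, false, (false, false)⟩

/-- The information bit `b_B(i)` Bob sends in a round, given the erasure `e1` of the
round's odd timestep and the state `s` at the beginning of the round. -/
def bobSentBit (fA fB : List Bool → Bool) (e1 : Bool) (s : St) : Bool :=
  let b := fA s.TA
  let bobErr : Bool := e1 || (par (s.rA + 1) == par s.rB)
  if bobErr then s.m.1 else fB (s.TB ++ [b])

/-- One round of the coding scheme Π of Algorithms 1–2; `e.1`/`e.2` tell whether the
odd/even timestep of the round is erased.  After Alice terminates (`rA = N/2`) the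
recorded state no longer changes (Bob only resends his stored message upon erasures,
and terminates upon hearing silence). -/
def step (fA fB : List Bool → Bool) (N : ℕ) (e : Bool × Bool) (s : St) : St :=
  if s.rA < N / 2 then
    -- odd timestep: Alice extends and sends (b, parity)
    let b := fA s.TA
    let rA1 := s.rA + 1
    -- Bob receives (⊥ if e.1)
    let bobErr : Bool := e.1 || (par rA1 == par s.rB)
    let TB' := if bobErr then s.TB else (s.TB ++ [b]) ++ [fB (s.TB ++ [b])]
    let rB' := if bobErr then s.rB else s.rB + 1
    let m' := if bobErr then s.m else (fB (s.TB ++ [b]), par (s.rB + 1))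
    -- even timestep: Bob sends m'; Alice receives (⊥ if e.2)
    let aliceOk : Bool := !e.2 && (m'.2 == par rA1)
    let TA' := if aliceOk then (s.TA ++ [b]) ++ [m'.1] else s.TA
    let rA' := if aliceOk then rA1 else s.rA
    ⟨TA', rA', TB', rB', bobErr, m'⟩
  else s

/-- `exec fA fB N E k` is the state after `k` rounds have been played. -/
def exec (fA fB : List Bool → Bool) (N : ℕ) (E : ℕ → Bool × Bool) : ℕ → St
  | 0 => init
  | k + 1 => step fA fB N (E (k + 1)) (exec fA fB N E k)

/-- `stAt fA fB N E i` is the state at the beginning of round `i` (rounds 1-indexed):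
for a protocol variable `v`, `v(i) = (stAt … i).v`. -/
def stAt (fA fB : List Bool → Bool) (N : ℕ) (E : ℕ → Bool × Bool) (i : ℕ) : St :=
  exec fA fB N E (i - 1)

/-- The noiseless transcript of `π` after `r` rounds; `transcript fA fB (N/2)` is `T^π`. -/
def transcript (fA fB : List Bool → Bool) : ℕ → List Bool
  | 0 => []
  | r + 1 =>
    let t := transcript fA fB r
    (t ++ [fA t]) ++ [fB (t ++ [fA t])]

/-- The number of erased timesteps in the first `k` rounds. -/
def erasures (E : ℕ → Bool × Bool) (k : ℕ) : ℕ :=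
  (Finset.Icc 1 k).sum fun i => (if (E i).1 then 1 else 0) + (if (E i).2 then 1 else 0)

lemma erasures_succ (E : ℕ → Bool × Bool) (k : ℕ) :
    erasures E (k + 1) = erasures E k +
      ((if (E (k + 1)).1 then 1 else 0) + (if (E (k + 1)).2 then 1 else 0)) := by
  unfold erasures
  rw [Finset.sum_Icc_succ_top (by omega)]

lemma erasures_add_le (E : ℕ → Bool × Bool) (a n : ℕ)
    (h : ∀ i, a < i → i ≤ a + n → (E i).1 = true) :
    erasures E a + n ≤ erasures E (a + n) := by
  induction n with
  | zero => simp
  | succ n ih =>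
    have h1 := ih fun i hi hin => h i hi (by omega)
    have h2 := h (a + n + 1) (by omega) (by omega)
    have h3 := erasures_succ E (a + n)
    rw [h2] at h3
    simp only [if_true] at h3
    rw [← add_assoc a n 1]
    omega

lemma par_succ (r : ℕ) : par (r + 1) = !par r := by
  unfold par
  rcases Nat.mod_two_eq_zero_or_one r with h | h <;> simp [Nat.add_mod, h]

/-- Both transcripts are noiseless prefixes, Bob is at most one round ahead of Alice, and
whenever he is ahead his stored message carries the bit Alice is missing. -/
structure Good (fA fB : List Bool → Bool) (N : ℕ) (s : St) : Prop where
  TA_eq : s.TA = transcript fA fB s.rA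
  TB_eq : s.TB = transcript fA fB s.rB
  rB_eq : s.rB = s.rA ∨ s.rB = s.rA + 1
  rB_le : s.rB ≤ N / 2
  parity : s.m.2 = par s.rB
  bit : s.rB = s.rA + 1 → s.m.1 = fB (s.TA ++ [fA s.TA])

lemma good_init (fA fB : List Bool → Bool) (N : ℕ) : Good fA fB N init := by
  constructor <;> simp [init, transcript, par]

lemma good_step {fA fB : List Bool → Bool} {N : ℕ} (e : Bool × Bool) {s : St}
    (hs : Good fA fB N s) : Good fA fB N (step fA fB N e s) := by
  by_cases hr : s.rA < N / 2
  swap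
  · simpa [step, hr] using hs
  obtain ⟨e1, e2⟩ := e
  obtain ⟨TA, rA, TB, rB, err, b, p⟩ := s
  obtain ⟨h1, h2, h3, h4, h5, h6⟩ := hs
  dsimp only at *
  subst h1 h2 h5
  rcases h3 with rfl | rfl
  · cases e1 <;> cases e2 <;> constructor <;> simp [step, hr, par_succ, transcript] <;> omega
  · have h7 := h6 rfl
    subst h7
    cases e1 <;> cases e2 <;> constructor <;> simp [step, hr, transcript]

lemma good_exec (fA fB : List Bool → Bool) (N : ℕ) (E : ℕ → Bool × Bool) (k : ℕ) :
    Good fA fB N (exec fA fB N E k) := by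
  induction k with
  | zero => exact good_init fA fB N
  | succ k ih => exact good_step _ ih

/-- Alice advances in every round without erasures, and never falls back. -/
lemma rA_step {fA fB : List Bool → Bool} {N : ℕ} (e : Bool × Bool) {s : St}
    (hs : Good fA fB N s) (hr : s.rA < N / 2) :
    s.rA + 1 ≤ (step fA fB N e s).rA +
      ((if e.1 then 1 else 0) + (if e.2 then 1 else 0)) := by
  obtain ⟨e1, e2⟩ := e
  obtain ⟨TA, rA, TB, rB, err, b, p⟩ := s
  obtain ⟨-, -, h3, -, h5, -⟩ := hs
  dsimp only at *
  subst h5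
  rcases h3 with rfl | rfl <;> cases e1 <;> cases e2 <;> simp [step, hr, par_succ]

lemma le_rA_add_erasures (fA fB : List Bool → Bool) (N : ℕ) (E : ℕ → Bool × Bool) (k : ℕ)
    (h : ∀ j < k, (exec fA fB N E j).rA < N / 2) :
    k ≤ (exec fA fB N E k).rA + erasures E k := by
  induction k with
  | zero => simp
  | succ k ih =>
    have h1 := ih fun j hj => h j (by omega)
    have h2 := rA_step (E (k + 1)) (good_exec fA fB N E k) (h k (by omega))
    have h3 := erasures_succ E k
    change k + 1 ≤ (step fA fB N (E (k + 1)) (exec fA fB N E k)).rA + _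
    omega

lemma exec_add_of_terminated {fA fB : List Bool → Bool} {N : ℕ} {E : ℕ → Bool × Bool} {k : ℕ}
    (h : N / 2 ≤ (exec fA fB N E k).rA) (n : ℕ) :
    exec fA fB N E (k + n) = exec fA fB N E k := by
  induction n with
  | zero => rfl
  | succ n ih =>
    change step fA fB N _ (exec fA fB N E (k + n)) = _
    rw [ih, step, if_neg (by omega)]

/-- Theorem 8 of the paper.  If the erasure pattern erases at most
`T` timesteps in total, then in the execution of Π both parties terminate (Alice at
some round `t_A`, Bob at some round `t_B > t_A`, upon the first unerased silence),
both output the noiseless transcript `T^π`, the total number of symbols sent is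
`t_A + t_B - 1 ≤ N + 2T`, and hence the communication in bits over the 4-ary
alphabet is at most `2N + 4T`. -/
theorem scheme1_simulation
    (fA fB : List Bool → Bool) (N T : ℕ) (hN : 0 < N) (hNeven : Even N)
    (E : ℕ → Bool × Bool)
    (hT : ∀ n, ((Finset.Icc 1 n).sum fun i =>
        (if (E i).1 then 1 else 0) + (if (E i).2 then 1 else 0)) ≤ T) :
    ∃ tA tB : ℕ,
      1 ≤ tA ∧ tA < tB ∧
      -- Alice terminates at round tA …
      (∀ i, 1 ≤ i → i ≤ tA → (stAt fA fB N E i).rA < N / 2) ∧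
      (stAt fA fB N E (tA + 1)).rA = N / 2 ∧
      -- … and Bob terminates at round tB, upon his first unerased (silent) reception
      (∀ i, tA < i → i < tB → (E i).1 = true) ∧
      (E tB).1 = false ∧
      -- both output the noiseless transcript T^π
      (stAt fA fB N E (tA + 1)).TA = transcript fA fB (N / 2) ∧
      (stAt fA fB N E (tB + 1)).TB = transcript fA fB (N / 2) ∧
      -- communication bounds
      tA + tB - 1 ≤ N + 2 * T ∧
      2 * (tA + tB - 1) ≤ 2 * N + 4 * T := by
  change ∀ n, erasures E n ≤ T at hT
  have hN2 : 0 < N / 2 := by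
    obtain ⟨c, rfl⟩ := hNeven
    omega
  have hA : ∃ k, N / 2 ≤ (exec fA fB N E k).rA := by
    by_contra! hcon
    have h1 := le_rA_add_erasures fA fB N E (N / 2 + T) fun j _ => hcon j
    have h2 := hcon (N / 2 + T)
    have h3 := hT (N / 2 + T)
    omega
  obtain ⟨tA, htA, hmin⟩ : ∃ tA, N / 2 ≤ (exec fA fB N E tA).rA ∧
      ∀ j < tA, (exec fA fB N E j).rA < N / 2 :=
    ⟨Nat.find hA, Nat.find_spec hA, fun j hj => not_le.mp (Nat.find_min hA hj)⟩
  have hB : ∃ i, tA < i ∧ (E i).1 = false := by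
    by_contra! hcon
    have h1 := erasures_add_le E tA (T + 1) fun i hi _ => by simpa using hcon i hi
    have h2 := hT (tA + (T + 1))
    omega
  obtain ⟨tB, ⟨hlt, hE⟩, hminB⟩ : ∃ tB, (tA < tB ∧ (E tB).1 = false) ∧
      ∀ i, tA < i → i < tB → (E i).1 = true :=
    ⟨Nat.find hB, Nat.find_spec hB, fun i hi hiB => by
      simpa [hi] using Nat.find_min hB hiB⟩
  have hgood := good_exec fA fB N E tA
  have hrB := hgood.rB_le
  have hcase := hgood.rB_eq
  have hrA_eq : (exec fA fB N E tA).rA = N / 2 := by omega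
  have hrB_eq : (exec fA fB N E tA).rB = N / 2 := by omega
  have hpos : 1 ≤ tA := by
    rcases Nat.eq_zero_or_pos tA with rfl | h
    · simp [exec, init] at htA
      omega
    · exact h
  have hexec : exec fA fB N E tB = exec fA fB N E tA := by
    have h := exec_add_of_terminated htA (tB - tA)
    rwa [Nat.add_sub_cancel' hlt.le] at h
  have hcount := le_rA_add_erasures fA fB N E tA hmin
  have hsilent := erasures_add_le E tA (tB - 1 - tA) fun i hi hi' =>
    hminB i hi (by omega)
  have hT1 := hT tA
  have hT2 := hT (tA + (tB - 1 - tA))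
  have hcomm : tA + tB - 1 ≤ N + 2 * T := by omega
  refine ⟨tA, tB, hpos, hlt, fun i hi hi' => hmin (i - 1) (by omega), hrA_eq, hminB, hE,
    ?_, ?_, hcomm, by omega⟩
  · change (exec fA fB N E tA).TA = _
    rw [hgood.TA_eq, hrA_eq]
  · change (exec fA fB N E tB).TB = _
    rw [hexec, hgood.TB_eq, hrB_eq]

end Scheme1
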